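/- arXiv:0907.0690 — 2 statements merged into one kernel-verified Lean document; each statement's English description precedes it below -/
import Mathlib

section
/- Let v₁ and v₂ be consistently oriented, asymptotic, unit spacelike vectors in ℝ³ with v₁⁻ = v₂⁺, and let p₁, p₂ ∈ ℝ³. The crooked planes C(v₁,p₁) and C(v₂,p₂) are disjoint if and only if (p₂−p₁)·v₁ < 0, (p₂−p₁)·v₂ < 0, and (p₂−p₁)·(v₁⁺⊠v₂⁻) > 0. -/
open Matrix

noncomputable section

/-- Minkowski space: ℝ³. -/
abbrev V3 : Type := Fin 3 → ℝ

/-- The Lorentzian inner product `x·y = x₁y₁ + x₂y₂ − x₃y₃`. -/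
def mdot (x y : V3) : ℝ := x 0 * y 0 + x 1 * y 1 - x 2 * y 2

/-- The Lorentzian cross product: the unique bilinear map with
`mdot u (lcross v w) = det [u v w]` (columns `u`, `v`, `w`). -/
def lcross (v w : V3) : V3 :=
  ![v 1 * w 2 - v 2 * w 1, v 2 * w 0 - v 0 * w 2, -(v 0 * w 1 - v 1 * w 0)]

/-- For a spacelike vector `v`, the future-pointing null vector `v⁺` of Euclidean
length 1 which is Lorentz-orthogonal to `v`, where `v⁻, v⁺` are ordered so that
`det[v⁻ v⁺ v] > 0`. -/
def nullPlus (v : V3) : V3 :=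
  (1 / (Real.sqrt 2 * (v 0 ^ 2 + v 1 ^ 2))) •
    ![v 0 * v 2 + v 1 * Real.sqrt (mdot v v),
      v 1 * v 2 - v 0 * Real.sqrt (mdot v v),
      v 0 ^ 2 + v 1 ^ 2]

/-- For a spacelike vector `v`, the future-pointing null vector `v⁻` of Euclidean
length 1 which is Lorentz-orthogonal to `v`, where `v⁻, v⁺` are ordered so that
`det[v⁻ v⁺ v] > 0`. -/
def nullMinus (v : V3) : V3 :=
  (1 / (Real.sqrt 2 * (v 0 ^ 2 + v 1 ^ 2))) •
    ![v 0 * v 2 - v 1 * Real.sqrt (mdot v v),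
      v 1 * v 2 + v 0 * Real.sqrt (mdot v v),
      v 0 ^ 2 + v 1 ^ 2]

/-- `P(x)`: for a future-pointing null vector `x`, the set of spacelike vectors `w`
with `w·x = 0` such that `(w/√(w·w))⁺` is a positive scalar multiple of `x`. -/
def wingSet (x : V3) : Set V3 :=
  {w | 0 < mdot w w ∧ mdot w x = 0 ∧
    ∃ t : ℝ, 0 < t ∧ nullPlus ((Real.sqrt (mdot w w))⁻¹ • w) = t • x}

/-- The crooked plane `C(v,p)`: union of the stem `p + {x | x·v = 0, x·x ≤ 0}`
and the wings `p + P(v⁺)` and `p + P(v⁻)`. -/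
def crookedPlane (v p : V3) : Set V3 :=
  {q | mdot (q - p) v = 0 ∧ mdot (q - p) (q - p) ≤ 0} ∪
  {q | q - p ∈ wingSet (nullPlus v)} ∪
  {q | q - p ∈ wingSet (nullMinus v)}

/-- The crooked half-space `H(v,p)`. -/
def crookedHalf (v p : V3) : Set V3 :=
  {q | (0 ≤ mdot (q - p) v → mdot (q - p) (nullPlus v) ≤ 0) ∧
       (mdot (q - p) v ≤ 0 → 0 ≤ mdot (q - p) (nullMinus v))}

/-- Spacelike vectors `u`, `v` are consistently oriented. -/
def consistentlyOriented (u v : V3) : Prop :=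
  mdot u v < 0 ∧ mdot u (nullPlus v) ≤ 0 ∧ mdot u (nullMinus v) ≤ 0 ∧
  mdot v (nullPlus u) ≤ 0 ∧ mdot v (nullMinus u) ≤ 0

/-- `g` is a linear isometry of the Lorentzian inner product. -/
def isLorentz (g : Matrix (Fin 3) (Fin 3) ℝ) : Prop :=
  ∀ x y : V3, mdot (g.mulVec x) (g.mulVec y) = mdot x y

/-- Membership in `SO(2,1)⁰`, the identity component of the group of linear
isometries of `mdot`: Lorentzian, determinant one, and orthochronous. -/
def inSO21p (g : Matrix (Fin 3) (Fin 3) ℝ) : Prop :=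
  isLorentz g ∧ g.det = 1 ∧ 0 < g.mulVec ![0, 0, 1] 2

/-- `g` is hyperbolic: it has three distinct real eigenvalues. -/
def isHyperbolic (g : Matrix (Fin 3) (Fin 3) ℝ) : Prop :=
  ∃ a b c : ℝ, a ≠ b ∧ a ≠ c ∧ b ≠ c ∧
    g.charpoly = (Polynomial.X - Polynomial.C a) * (Polynomial.X - Polynomial.C b) *
      (Polynomial.X - Polynomial.C c)

/-- `g ≠ I` is parabolic: `1` is its only eigenvalue. -/
def isParabolic (g : Matrix (Fin 3) (Fin 3) ℝ) : Prop :=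
  g ≠ 1 ∧ g.charpoly = (Polynomial.X - Polynomial.C 1) ^ 3

/-- `v` is a positive fixed vector of `g`: `gv = v`, `v ≠ 0`, and
`det[v x gx] > 0` for some null or timelike `x` which is not an eigenvector. -/
def positiveFixed (g : Matrix (Fin 3) (Fin 3) ℝ) (v : V3) : Prop :=
  v ≠ 0 ∧ g.mulVec v = v ∧
  ∃ x : V3, mdot x x ≤ 0 ∧ (∀ t : ℝ, g.mulVec x ≠ t • x) ∧
    0 < mdot v (lcross x (g.mulVec x))

/-- A subgroup of homeomorphisms (here: permutations) of ℝ³ acts properly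
discontinuously: for every compact `K`, only finitely many elements move `K`
to meet `K`. -/
def properlyDisc (Γ : Subgroup (Equiv.Perm V3)) : Prop :=
  ∀ K : Set V3, IsCompact K →
    {f : Equiv.Perm V3 | f ∈ Γ ∧ ((f : V3 → V3) '' K ∩ K).Nonempty}.Finite

/-- The action of `Γ` on ℝ³ is free: no nonidentity element has a fixed point. -/
def freeAction (Γ : Subgroup (Equiv.Perm V3)) : Prop :=
  ∀ f ∈ Γ, f ≠ 1 → ∀ x : V3, f x ≠ x

lemma mdot_comm (x y : V3) : mdot x y = mdot y x := by
  simp only [mdot]; ring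

lemma mdot_add_left (x y z : V3) : mdot (x + y) z = mdot x z + mdot y z := by
  simp only [mdot, Pi.add_apply]; ring

lemma mdot_sub_left (x y z : V3) : mdot (x - y) z = mdot x z - mdot y z := by
  simp only [mdot, Pi.sub_apply]; ring

lemma mdot_smul_left (a : ℝ) (x y : V3) : mdot (a • x) y = a * mdot x y := by
  simp only [mdot, Pi.smul_apply, smul_eq_mul]; ring

lemma mdot_neg_left (x y : V3) : mdot (-x) y = -mdot x y := by
  simp only [mdot, Pi.neg_apply]; ring

lemma mdot_add_right (x y z : V3) : mdot x (y + z) = mdot x y + mdot x z := by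
  simp only [mdot, Pi.add_apply]; ring

lemma mdot_sub_right (x y z : V3) : mdot x (y - z) = mdot x y - mdot x z := by
  simp only [mdot, Pi.sub_apply]; ring

lemma mdot_smul_right (a : ℝ) (x y : V3) : mdot x (a • y) = a * mdot x y := by
  simp only [mdot, Pi.smul_apply, smul_eq_mul]; ring

lemma mdot_neg_right (x y : V3) : mdot x (-y) = -mdot x y := by
  simp only [mdot, Pi.neg_apply]; ring

lemma lcross_sub_left (x y z : V3) : lcross (x - y) z = lcross x z - lcross y z := by
  ext i; fin_cases i <;> simp [lcross] <;> ring

lemma lcross_smul_left (a : ℝ) (x y : V3) : lcross (a • x) y = a • lcross x y := by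
  ext i; fin_cases i <;> simp [lcross] <;> ring

lemma lcross_neg_left (x y : V3) : lcross (-x) y = -lcross x y := by
  ext i; fin_cases i <;> simp [lcross] <;> ring

lemma lcross_add_right (x y z : V3) : lcross x (y + z) = lcross x y + lcross x z := by
  ext i; fin_cases i <;> simp [lcross] <;> ring

lemma lcross_smul_right (a : ℝ) (x y : V3) : lcross x (a • y) = a • lcross x y := by
  ext i; fin_cases i <;> simp [lcross] <;> ring

lemma lcross_neg_right (x y : V3) : lcross x (-y) = -lcross x y := by
  ext i; fin_cases i <;> simp [lcross] <;> ring

lemma lcross_anticomm (x y : V3) : lcross x y = -lcross y x := by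
  ext i; fin_cases i <;> simp [lcross] <;> ring

lemma lcross_self (x : V3) : lcross x x = 0 := by
  ext i; fin_cases i <;> simp [lcross] <;> ring

lemma mdot_self_lcross (x y : V3) : mdot x (lcross x y) = 0 := by
  simp [mdot, lcross]; ring

/-- The Lorentzian triple product identity. -/
lemma lcross_lcross (u v x : V3) :
    lcross u (lcross v x) = mdot u v • x - mdot u x • v := by
  ext i; fin_cases i <;> simp [lcross, mdot] <;> ring

lemma eq_smul_of_lcross_eq_zero {u x : V3} (hx : x 2 ≠ 0) (h : lcross u x = 0) :
    u = (u 2 / x 2) • x := by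
  have h0 := congrFun h 0
  have h1 := congrFun h 1
  simp [lcross] at h0 h1
  ext i
  fin_cases i <;> simp <;> field_simp <;> linarith

lemma sq_add_sq_pos_of_spacelike {v : V3} (hv : 0 < mdot v v) : 0 < v 0 ^ 2 + v 1 ^ 2 := by
  simp only [mdot] at hv
  nlinarith [sq_nonneg (v 2)]

lemma nullPlus_two {v : V3} (hv : 0 < mdot v v) : nullPlus v 2 = 1 / √2 := by
  have := sq_add_sq_pos_of_spacelike hv
  simp [nullPlus]
  field_simp

lemma nullPlus_two_pos {v : V3} (hv : 0 < mdot v v) : 0 < nullPlus v 2 := by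
  rw [nullPlus_two hv]; positivity

lemma nullMinus_eq_nullPlus_neg (v : V3) : nullMinus v = nullPlus (-v) := by
  have : mdot (-v) (-v) = mdot v v := by simp [mdot]
  ext i
  fin_cases i <;> simp [nullMinus, nullPlus, this] <;> left <;> ring

lemma lcross_nullPlus {v : V3} (hv : mdot v v = 1) : lcross v (nullPlus v) = nullPlus v := by
  have h2 : v 0 ^ 2 + v 1 ^ 2 = 1 + v 2 ^ 2 := by simp only [mdot] at hv; linarith
  rw [nullPlus, lcross_smul_right]
  congr 1
  ext i
  fin_cases i <;> simp [lcross, hv]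
  · linear_combination v 1 * h2
  · linear_combination -v 0 * h2
  · ring

/-- `v⁺` is the only vector at height `1 / √2` fixed by `lcross v`. -/
lemma eq_nullPlus_of_lcross_eq {v x : V3} (hv : mdot v v = 1) (hx : lcross v x = x)
    (hx2 : x 2 = 1 / √2) : x = nullPlus v := by
  have hv0 : 0 < mdot v v := by rw [hv]; norm_num
  have key : lcross v (x - nullPlus v) = x - nullPlus v := by
    rw [lcross_anticomm, lcross_sub_left, lcross_anticomm x, lcross_anticomm (nullPlus v), hx,
      lcross_nullPlus hv]
    abel
  have hy2 : (x - nullPlus v) 2 = 0 := by simp [hx2, nullPlus_two hv0]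
  generalize hy : x - nullPlus v = y at key hy2
  have k0 := congrFun key 0
  have k1 := congrFun key 1
  simp [lcross, hy2] at k0 k1
  have e0 : y 0 = 0 := by
    have : (1 + v 2 ^ 2) * y 0 = 0 := by linear_combination v 2 * k1 - k0
    rcases mul_eq_zero.mp this with h | h
    · nlinarith [sq_nonneg (v 2)]
    · exact h
  have e1 : y 1 = 0 := by rw [← k1, e0, mul_zero]
  have : y = 0 := by
    ext i; fin_cases i
    exacts [e0, e1, hy2]
  exact sub_eq_zero.mp (hy.trans this)

lemma mdot_nullPlus {v : V3} (hv : mdot v v = 1) : mdot v (nullPlus v) = 0 := by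
  rw [← lcross_nullPlus hv, mdot_self_lcross]

lemma mdot_nullPlus_nullPlus {v : V3} (hv : mdot v v = 1) :
    mdot (nullPlus v) (nullPlus v) = 0 := by
  have h := mdot_self_lcross (nullPlus v) v
  rwa [lcross_anticomm, lcross_nullPlus hv, mdot_neg_right, neg_eq_zero] at h

lemma lcross_nullPlus_of_orthogonal {u v : V3} (hv : mdot v v = 1)
    (hu : mdot u (nullPlus v) = 0) : lcross u (nullPlus v) = mdot u v • nullPlus v := by
  conv_lhs => rw [← lcross_nullPlus hv]
  rw [lcross_lcross, hu, zero_smul, sub_zero]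

lemma exists_eq_add_smul_nullPlus {u v : V3} (hv : mdot v v = 1) {a : ℝ}
    (hu : lcross u (nullPlus v) = a • nullPlus v) : ∃ b : ℝ, u = a • v + b • nullPlus v := by
  have hv0 : 0 < mdot v v := by rw [hv]; norm_num
  have h : lcross (u - a • v) (nullPlus v) = 0 := by
    rw [lcross_sub_left, lcross_smul_left, hu, lcross_nullPlus hv, sub_self]
  have := eq_smul_of_lcross_eq_zero (nullPlus_two_pos hv0).ne' h
  exact ⟨_, sub_eq_iff_eq_add'.mp this⟩

lemma mem_wingSet_nullPlus {v w : V3} (hv : mdot v v = 1) :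
    w ∈ wingSet (nullPlus v) ↔ mdot w (nullPlus v) = 0 ∧ 0 < mdot w v := by
  have hv0 : 0 < mdot v v := by rw [hv]; norm_num
  have hx0 := nullPlus_two_pos hv0
  constructor
  · rintro ⟨hw, hwx, t, -, ht⟩
    refine ⟨hwx, ?_⟩
    have hs : 0 < √(mdot w w) := Real.sqrt_pos.mpr hw
    have hu : mdot ((√(mdot w w))⁻¹ • w) ((√(mdot w w))⁻¹ • w) = 1 := by
      rw [mdot_smul_left, mdot_smul_right]
      nth_rewrite 3 [← Real.mul_self_sqrt hw.le]
      field_simp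
    generalize hud : (√(mdot w w))⁻¹ • w = u at ht hu
    have ht1 : t = 1 := by
      have := congrFun ht 2
      rw [nullPlus_two (by rw [hu]; norm_num), Pi.smul_apply, ← nullPlus_two hv0,
        smul_eq_mul] at this
      exact mul_right_cancel₀ hx0.ne' (by linarith)
    rw [ht1, one_smul] at ht
    have hux := lcross_nullPlus hu
    rw [ht] at hux
    obtain ⟨b, hb⟩ := exists_eq_add_smul_nullPlus hv (a := 1) (by rw [hux, one_smul])
    have huv : mdot u v = 1 := by
      rw [hb, mdot_add_left, mdot_smul_left, mdot_smul_left, hv, mdot_comm, mdot_nullPlus hv]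
      ring
    have hw' : w = √(mdot w w) • u := by rw [← hud, smul_inv_smul₀ hs.ne']
    rw [hw', mdot_smul_left, huv, mul_one]
    exact hs
  · rintro ⟨hwx, hwv⟩
    have hc := lcross_nullPlus_of_orthogonal hv hwx
    obtain ⟨b, hb⟩ := exists_eq_add_smul_nullPlus hv hc
    have hww : mdot w w = mdot w v ^ 2 := by
      conv_lhs => rw [hb]
      simp only [mdot_add_left, mdot_add_right, mdot_smul_left, mdot_smul_right, hv,
        mdot_nullPlus hv, mdot_comm (nullPlus v) v, mdot_nullPlus_nullPlus hv]
      ring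
    refine ⟨by rw [hww]; positivity, hwx, 1, one_pos, ?_⟩
    rw [hww, Real.sqrt_sq hwv.le, one_smul, eq_comm]
    apply eq_nullPlus_of_lcross_eq
    · rw [mdot_smul_left, mdot_smul_right, hww]
      field_simp
    · rw [lcross_smul_left, hc, inv_smul_smul₀ hwv.ne']
    · exact nullPlus_two hv0

lemma mdot_neg_neg (v : V3) : mdot (-v) (-v) = mdot v v := by
  rw [mdot_neg_left, mdot_neg_right, neg_neg]

lemma mem_wingSet_nullMinus {v w : V3} (hv : mdot v v = 1) :
    w ∈ wingSet (nullMinus v) ↔ mdot w (nullMinus v) = 0 ∧ mdot w v < 0 := by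
  rw [nullMinus_eq_nullPlus_neg, mem_wingSet_nullPlus ((mdot_neg_neg v).trans hv),
    mdot_neg_right, neg_pos]

lemma mdot_nullMinus {v : V3} (hv : mdot v v = 1) : mdot v (nullMinus v) = 0 := by
  have := mdot_nullPlus ((mdot_neg_neg v).trans hv)
  rwa [← nullMinus_eq_nullPlus_neg, mdot_neg_left, neg_eq_zero] at this

lemma mdot_nullMinus_nullMinus {v : V3} (hv : mdot v v = 1) :
    mdot (nullMinus v) (nullMinus v) = 0 := by
  rw [nullMinus_eq_nullPlus_neg, mdot_nullPlus_nullPlus ((mdot_neg_neg v).trans hv)]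

lemma lcross_nullMinus {v : V3} (hv : mdot v v = 1) :
    lcross v (nullMinus v) = -nullMinus v := by
  have := lcross_nullPlus ((mdot_neg_neg v).trans hv)
  rwa [← nullMinus_eq_nullPlus_neg, lcross_neg_left, neg_eq_iff_eq_neg] at this

lemma mdot_nullPlus_nullMinus_neg {v : V3} (hv : mdot v v = 1) :
    mdot (nullPlus v) (nullMinus v) < 0 := by
  have hv0 : 0 < mdot v v := by rw [hv]; norm_num
  have hm := mdot_nullPlus_nullPlus hv
  have hn := mdot_nullMinus_nullMinus hv
  have hm2 := nullPlus_two hv0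
  have hn2 : nullMinus v 2 = 1 / √2 := by
    rw [nullMinus_eq_nullPlus_neg, nullPlus_two (by rwa [mdot_neg_neg])]
  have hne : nullPlus v ≠ nullMinus v := by
    intro h
    have h' := lcross_nullMinus hv
    rw [← h, lcross_nullPlus hv] at h'
    have := congrFun h' 2
    rw [Pi.neg_apply] at this
    linarith [nullPlus_two_pos hv0]
  generalize nullPlus v = m at *
  generalize nullMinus v = n at *
  by_contra! hle
  apply hne
  simp only [mdot, hm2, hn2] at hm hn hle
  have e0 : m 0 = n 0 := by nlinarith [sq_nonneg (m 0 - n 0), sq_nonneg (m 1 - n 1)]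
  have e1 : m 1 = n 1 := by nlinarith [sq_nonneg (m 0 - n 0), sq_nonneg (m 1 - n 1)]
  ext i
  fin_cases i
  exacts [e0, e1, hm2.trans hn2.symm]

/-- Expansion of a vector in the basis `v, v⁺, v⁻`. -/
lemma eq_null_frame_expansion {v : V3} (hv : mdot v v = 1) (q : V3) :
    q = mdot q v • v
      + (mdot q (nullMinus v) / mdot (nullPlus v) (nullMinus v)) • nullPlus v
      + (mdot q (nullPlus v) / mdot (nullPlus v) (nullMinus v)) • nullMinus v := by
  have hk := (mdot_nullPlus_nullMinus_neg hv).ne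
  rw [← sub_eq_zero]
  generalize hr : q - _ = r
  have hrv : mdot r v = 0 := by
    rw [← hr]
    simp only [mdot_sub_left, mdot_add_left, mdot_smul_left, hv, mdot_comm (nullPlus v) v,
      mdot_comm (nullMinus v) v, mdot_nullPlus hv, mdot_nullMinus hv]
    ring
  have hrm : mdot r (nullPlus v) = 0 := by
    rw [← hr]
    simp only [mdot_sub_left, mdot_add_left, mdot_smul_left, mdot_comm (nullMinus v),
      mdot_nullPlus hv, mdot_nullPlus_nullPlus hv]
    field_simp
    ring
  have hrn : mdot r (nullMinus v) = 0 := by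
    rw [← hr]
    simp only [mdot_sub_left, mdot_add_left, mdot_smul_left,
      mdot_nullMinus hv, mdot_nullMinus_nullMinus hv]
    field_simp
    ring
  obtain ⟨b, hb⟩ := exists_eq_add_smul_nullPlus hv (lcross_nullPlus_of_orthogonal hv hrm)
  rw [hrv, zero_smul, zero_add] at hb
  rw [hb, mdot_smul_left] at hrn
  rw [hb, (mul_eq_zero.mp hrn).resolve_right hk, zero_smul]

lemma mdot_self_eq_null_frame {v : V3} (hv : mdot v v = 1) (q : V3) :
    mdot q q = mdot q v ^ 2 + 2 * (mdot q (nullPlus v) * mdot q (nullMinus v))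
      / mdot (nullPlus v) (nullMinus v) := by
  have hk := (mdot_nullPlus_nullMinus_neg hv).ne
  conv_lhs => rw [eq_null_frame_expansion hv q]
  simp only [mdot_add_left, mdot_add_right, mdot_smul_left, mdot_smul_right, hv,
    mdot_comm _ v, mdot_comm (nullMinus v) (nullPlus v), mdot_nullPlus hv, mdot_nullMinus hv,
    mdot_nullPlus_nullPlus hv, mdot_nullMinus_nullMinus hv]
  field_simp
  ring

/-- The crooked plane condition in terms of the products `X`, `M`, `N` of a displacement with
`v`, `v⁺`, `v⁻`. -/
def crookedCoord (X M N : ℝ) : Prop :=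
  (X = 0 ∧ 0 ≤ M * N) ∨ (M = 0 ∧ 0 < X) ∨ (N = 0 ∧ X < 0)

lemma mem_crookedPlane_iff {v : V3} (hv : mdot v v = 1) (p q : V3) :
    q ∈ crookedPlane v p ↔
      crookedCoord (mdot (q - p) v) (mdot (q - p) (nullPlus v)) (mdot (q - p) (nullMinus v)) := by
  have hk := mdot_nullPlus_nullMinus_neg hv
  simp only [crookedPlane, crookedCoord, Set.mem_union, Set.mem_ofPred_eq,
    mem_wingSet_nullPlus hv, mem_wingSet_nullMinus hv, or_assoc]
  refine or_congr (and_congr_right fun h0 => ?_) Iff.rfl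
  rw [mdot_self_eq_null_frame hv, h0, zero_pow two_ne_zero, zero_add,
    div_le_iff_of_neg hk]
  constructor <;> intro h <;> linarith

/-- Two crooked planes sharing a null direction, in the coordinates of the first one, with the
vertex of the second at `(a, b, g)`. -/
lemma not_exists_crookedCoord_iff {a b g c k l : ℝ} (hc : 0 ≤ c) (hk : 0 < k) (hl : 0 < l) :
    (¬ ∃ X M N : ℝ, crookedCoord X M N ∧ crookedCoord (-(X - a) + c * (N - g)) (N - g)
      (l * ((M - b) - c * k * (X - a) + c ^ 2 * k / 2 * (N - g)))) ↔
    (a < 0 ∧ -a + c * g < 0 ∧ 0 < l * (c * k * b - c ^ 2 * k ^ 2 / 2 * a)) := by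
  constructor
  · intro H
    have ha : a < 0 := by
      by_contra! ha
      apply H
      rcases ha.eq_or_lt with rfl | ha
      · exact ⟨0, 0, g, Or.inl ⟨rfl, by simp⟩, Or.inl ⟨by ring, by simp⟩⟩
      · exact ⟨a / 2, 0, g, Or.inr (Or.inl ⟨rfl, by linarith⟩),
          Or.inr (Or.inl ⟨by ring, by linarith⟩)⟩
    have hg : -a + c * g < 0 := by
      by_contra! hg
      apply H
      rcases hg.eq_or_lt with hg | hg
      · refine ⟨0, b - c * k * a + c ^ 2 * k / 2 * g, 0, Or.inl ⟨rfl, by simp⟩,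
          Or.inl ⟨by linarith, le_of_eq ?_⟩⟩
        ring
      · refine ⟨-(-a + c * g) / 2,
          b + c * k * (-(-a + c * g) / 2 - a) + c ^ 2 * k / 2 * g, 0,
          Or.inr (Or.inr ⟨rfl, by linarith⟩), Or.inr (Or.inr ⟨by ring, by linarith⟩)⟩
    refine ⟨ha, hg, ?_⟩
    have hc : 0 < c := by
      rcases hc.eq_or_lt with rfl | h
      · linarith
      · exact h
    by_contra! hb
    have hb' : 2 * b - c * k * a ≤ 0 := by
      by_contra! h
      have : 0 < l * (c * k / 2) * (2 * b - c * k * a) := by positivity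
      linarith
    apply H
    rcases hb'.eq_or_lt with hb' | hb'
    · refine ⟨0, 0, g - a / c, Or.inl ⟨rfl, by simp⟩, Or.inl ⟨?_, le_of_eq ?_⟩⟩
      · field_simp; ring
      · field_simp
        linear_combination (-a * l) * hb'
    · have hpos : 0 < a - 2 * b / (c * k) := by
        have : a - 2 * b / (c * k) = -(2 * b - c * k * a) / (c * k) := by field_simp; ring
        rw [this]
        exact div_pos (by linarith) (by positivity)
      generalize hX : (a - 2 * b / (c * k)) / 2 = X
      refine ⟨X, 0, g + 2 * (b + c * k * (X - a)) / (c ^ 2 * k),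
        Or.inr (Or.inl ⟨rfl, by linarith⟩), Or.inr (Or.inr ⟨?_, ?_⟩)⟩
      · field_simp; ring
      · have : -(X - a) + c * (g + 2 * (b + c * k * (X - a)) / (c ^ 2 * k) - g)
            = X - (a - 2 * b / (c * k)) := by field_simp; ring
        rw [this]
        linarith
  · rintro ⟨ha, hg, hb⟩ ⟨X, M, N, h1, h2⟩
    have hc : 0 < c := by
      rcases hc.eq_or_lt with rfl | h
      · linarith
      · exact h
    have hg0 : g < 0 := by
      by_contra! h
      nlinarith [mul_nonneg hc.le h]
    have hb' : 0 < 2 * b - c * k * a := by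
      have : 0 < l * (c * k / 2) * (2 * b - c * k * a) := by linarith
      exact (mul_pos_iff_of_pos_left (by positivity)).mp this
    have hck : 0 < c * k / 2 := by positivity
    generalize hS : -(X - a) + c * (N - g) = S at h2
    generalize hE : M - b - c * k * (X - a) + c ^ 2 * k / 2 * (N - g) = E at h2
    generalize hZ : N - g = Z at h2 hS hE
    have hE' : E = M - (2 * b - c * k * a) / 2 + c * k / 2 * (S - X) := by
      rw [← hE, ← hS]; ring
    have hcN : c * N = S + X - (a - c * g) := by rw [← hS, ← hZ]; ring
    have hsign (hS0 : S ≤ 0) : 0 ≤ X ∧ M ≤ 0 := by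
      rcases h1 with ⟨rfl, h1⟩ | ⟨rfl, h1⟩ | ⟨rfl, h1⟩
      · have hN : N < 0 := by
          by_contra! h
          nlinarith [mul_nonneg hc.le h]
        refine ⟨le_rfl, ?_⟩
        by_contra! h
        nlinarith [mul_neg_of_pos_of_neg h hN]
      · exact ⟨h1.le, le_rfl⟩
      · linarith
    rcases h2 with ⟨rfl, h2⟩ | ⟨rfl, h2⟩ | ⟨h3, h2⟩
    · have hZE : 0 ≤ Z * E := by
        have : 0 ≤ l * (Z * E) := by linarith
        exact nonneg_of_mul_nonneg_right this hl
      obtain ⟨hX, hM⟩ := hsign le_rfl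
      have hZ0 : 0 < Z := (mul_pos_iff_of_pos_left hc).mp (by linarith)
      have hE0 := nonneg_of_mul_nonneg_right hZE hZ0
      nlinarith [mul_nonneg hck.le hX]
    · rcases h1 with ⟨rfl, h1⟩ | ⟨rfl, h1⟩ | ⟨rfl, h1⟩ <;> linarith
    · have hE0 : E = 0 := (mul_eq_zero.mp h3).resolve_left hl.ne'
      obtain ⟨hX, hM⟩ := hsign h2.le
      nlinarith [mul_nonneg hck.le hX, mul_neg_of_pos_of_neg hck h2]

/-- Disjointness criterion for crooked planes with consistently
oriented, asymptotic (i.e. `v₁⊠v₂` null) unit spacelike direction vectors with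
`v₁⁻ = v₂⁺`: `C(v₁,p₁) ∩ C(v₂,p₂) = ∅` iff `(p₂−p₁)·v₁ < 0`, `(p₂−p₁)·v₂ < 0`
and `(p₂−p₁)·(v₁⁺ ⊠ v₂⁻) > 0`. -/
theorem crooked_planes_disjoint_iff_asymptotic
    (v1 v2 p1 p2 : V3)
    (h1 : mdot v1 v1 = 1) (h2 : mdot v2 v2 = 1)
    (hco : consistentlyOriented v1 v2)
    (hasym : mdot (lcross v1 v2) (lcross v1 v2) = 0)
    (hmp : nullMinus v1 = nullPlus v2) :
    crookedPlane v1 p1 ∩ crookedPlane v2 p2 = ∅ ↔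
      (mdot (p2 - p1) v1 < 0 ∧ mdot (p2 - p1) v2 < 0 ∧
        0 < mdot (p2 - p1) (lcross (nullPlus v1) (nullMinus v2))) := by
  have hk := mdot_nullPlus_nullMinus_neg h1
  have hk2 := mdot_nullPlus_nullMinus_neg h2
  have hvm := mdot_nullPlus h1
  have hvn := mdot_nullMinus h1
  have hmm := mdot_nullPlus_nullPlus h1
  have hnn := mdot_nullMinus_nullMinus h1
  have hlcm : lcross (nullPlus v1) v1 = -nullPlus v1 := by
    rw [lcross_anticomm, lcross_nullPlus h1]
  have hlcn : lcross (nullPlus v1) (nullMinus v1)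
      = mdot (nullPlus v1) (nullMinus v1) • v1 := by
    have h : nullMinus v1 = -lcross v1 (nullMinus v1) := by rw [lcross_nullMinus h1, neg_neg]
    conv_lhs => rw [h]
    rw [lcross_neg_right, lcross_lcross, mdot_comm _ v1, hvm, zero_smul, zero_sub, neg_neg]
  obtain ⟨c, hv2⟩ : ∃ c : ℝ, v2 = -v1 + c • nullMinus v1 := by
    have h := lcross_nullPlus h2
    rw [← hmp, nullMinus_eq_nullPlus_neg] at h
    obtain ⟨c, hc⟩ := exists_eq_add_smul_nullPlus ((mdot_neg_neg v1).trans h1) (a := 1)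
      (h.trans (one_smul _ _).symm)
    exact ⟨c, by rwa [one_smul, ← nullMinus_eq_nullPlus_neg] at hc⟩
  have hc : 0 ≤ c := by
    have h := hco.2.2.2.1
    rw [hv2, mdot_add_left, mdot_neg_left, hvm, mdot_smul_left,
      mdot_comm (nullMinus v1)] at h
    by_contra! h'
    nlinarith [mul_pos_of_neg_of_neg h' hk]
  have hl := eq_null_frame_expansion h1 (nullMinus v2)
  have hlv2 := mdot_nullMinus h2
  have hll := mdot_self_eq_null_frame h1 (nullMinus v2)
  rw [mdot_nullMinus_nullMinus h2] at hll
  rw [← hmp, mdot_comm] at hk2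
  rw [hv2, mdot_add_left, mdot_neg_left, mdot_smul_left, mdot_comm v1, mdot_comm (nullMinus v1),
    ← hv2] at hlv2
  simp only [Set.eq_empty_iff_forall_notMem, Set.mem_inter_iff, ← not_exists,
    mem_crookedPlane_iff h1, mem_crookedPlane_iff h2, ← hmp]
  generalize nullMinus v2 = l at *
  generalize nullPlus v1 = m at *
  generalize nullMinus v1 = n at *
  obtain ⟨k, hkd⟩ : ∃ k, mdot m n = -k := ⟨_, (neg_neg _).symm⟩
  have hk0 : 0 < k := by linarith
  rw [hkd] at hk hlcn hl hll
  generalize hlam : mdot l n / -k = lam at *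
  have hlam0 : 0 < lam := by rw [← hlam]; exact div_pos_of_neg_of_neg hk2 hk
  have hln : mdot l n = -k * lam := by rw [← hlam]; field_simp
  have hlv : mdot l v1 = -(c * k * lam) := by linear_combination -hlv2 + c * hln
  have hlm : mdot l m / -k = lam * (c ^ 2 * k / 2) := by
    rw [hln, hlv] at hll
    field_simp at hll ⊢
    nlinarith
  have hl' : l = lam • (m + (-(c * k)) • v1 + (c ^ 2 * k / 2) • n) := by
    rw [hl, hlv, hlm]
    ext i
    simp
    ring
  have hcross : lcross m l = lam • ((c * k) • m - (c ^ 2 * k ^ 2 / 2) • v1) := by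
    rw [hl', lcross_smul_right, lcross_add_right, lcross_add_right, lcross_self,
      lcross_smul_right, lcross_smul_right, hlcm, hlcn]
    congr 1
    ext i
    simp
    ring
  have hfin := not_exists_crookedCoord_iff (a := mdot (p2 - p1) v1) (b := mdot (p2 - p1) m)
    (g := mdot (p2 - p1) n) hc hk0 hlam0
  rw [hcross, hl', mdot_smul_right, mdot_sub_right, mdot_smul_right, mdot_smul_right]
  have hdv2 (q : V3) : mdot q v2 = -mdot q v1 + c * mdot q n := by
    rw [hv2, mdot_add_right, mdot_neg_right, mdot_smul_right]
  have hdl (q : V3) : mdot q (lam • (m + (-(c * k)) • v1 + (c ^ 2 * k / 2) • n))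
      = lam * (mdot q m - c * k * mdot q v1 + c ^ 2 * k / 2 * mdot q n) := by
    simp only [mdot_add_right, mdot_smul_right]; ring
  rw [hdv2, ← hfin, not_iff_not]
  have hsub (q x : V3) : mdot (q - p2) x = mdot (q - p1) x - mdot (p2 - p1) x := by
    simp only [mdot_sub_left]; ring
  simp only [hdl, hdv2]
  constructor
  · rintro ⟨q, hq1, hq2⟩
    refine ⟨_, _, _, hq1, ?_⟩
    simpa only [← hsub] using hq2
  · rintro ⟨X, M, N, hX1, hX2⟩
    have hr : ∃ q : V3, mdot (q - p1) v1 = X ∧ mdot (q - p1) m = M ∧ mdot (q - p1) n = N := by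
      refine ⟨p1 + (X • v1 + (N / -k) • m + (M / -k) • n), ?_, ?_, ?_⟩ <;>
        rw [add_sub_cancel_left] <;>
        simp only [mdot_add_left, mdot_smul_left, h1, hvm, hvn, hmm, hnn, hkd,
          mdot_comm m v1, mdot_comm n v1, mdot_comm n m] <;>
        field_simp <;> ring
    obtain ⟨q, rfl, rfl, rfl⟩ := hr
    refine ⟨q, hX1, ?_⟩
    simpa only [hsub] using hX2
end
end

section
/- Let π be a free group of rank two with free generators A₁, A₂, and set A₃ := (A₁A₂)⁻¹, so A₁A₂A₃ = 1. Let ρ₀: π → SO(2,1)⁰ be a homomorphism such that ρ₀(Aᵢ) is hyperbolic or parabolic for i = 1,2,3 and ρ₀(π) is not solvable. For each i choose a vector vᵢ fixed by ρ₀(Aᵢ) and positive with respect to ρ₀(Aᵢ). Then the map sending the class [u] ∈ H¹(π, ℝ³) of a cocycle u to (u(A₁)·v₁, u(A₂)·v₂, u(A₃)·v₃) ∈ ℝ³ is a well-defined linear isomorphism from H¹(π, ℝ³) onto ℝ³. -/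
open Matrix

noncomputable section

lemma mdot_mulVec_lcross_mulVec (g : Matrix (Fin 3) (Fin 3) ℝ) (u v w : V3) :
    mdot (g.mulVec u) (lcross (g.mulVec v) (g.mulVec w)) = g.det * mdot u (lcross v w) := by
  simp [mdot, lcross, Matrix.mulVec, dotProduct, Fin.sum_univ_three, Matrix.det_fin_three]
  ring

lemma eq_of_forall_mdot_eq {x y : V3} (h : ∀ z, mdot z x = mdot z y) : x = y := by
  have h0 := h ![1, 0, 0]
  have h1 := h ![0, 1, 0]
  have h2 := h ![0, 0, 1]
  simp [mdot] at h0 h1 h2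
  ext i
  fin_cases i <;> assumption

/-- Orientation-preserving Lorentz transformations preserve the Lorentzian cross product. -/
lemma lcross_mulVec {g : Matrix (Fin 3) (Fin 3) ℝ} (hg : isLorentz g) (hdet : g.det = 1)
    (v w : V3) : lcross (g.mulVec v) (g.mulVec w) = g.mulVec (lcross v w) := by
  refine eq_of_forall_mdot_eq fun z => ?_
  have hz : g.mulVec (g⁻¹.mulVec z) = z := by
    rw [Matrix.mulVec_mulVec, Matrix.mul_nonsing_inv _ (by simp [hdet]), Matrix.one_mulVec]
  rw [← hz, mdot_mulVec_lcross_mulVec, hg, hdet, one_mul]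

/-- Cramer's rule, in terms of the Lorentzian triple product. -/
lemma mdot_lcross_smul (p q r x : V3) :
    mdot p (lcross q r) • x =
      mdot x (lcross q r) • p + mdot p (lcross x r) • q + mdot p (lcross q x) • r := by
  ext i
  fin_cases i <;> simp [mdot, lcross] <;> ring

/-- The matrix of `x ↦ lcross v x`. -/
def lcrossMatrix (v : V3) : Matrix (Fin 3) (Fin 3) ℝ :=
  !![0, -v 2, v 1; v 2, 0, -v 0; v 1, -v 0, 0]

lemma lcrossMatrix_mulVec (v x : V3) : (lcrossMatrix v).mulVec x = lcross v x := by
  ext i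
  fin_cases i <;>
    simp [lcrossMatrix, lcross, Matrix.mulVec, dotProduct, Fin.sum_univ_three] <;> ring

/-- For `v ≠ 0` the linear map `x ↦ lcross v x` has a cyclic vector. -/
lemma exists_cyclic_lcross {v : V3} (hv : v ≠ 0) :
    ∃ y, mdot y (lcross (lcross v y) (lcross v (lcross v y))) ≠ 0 := by
  by_contra! h
  have h0 := h ![1, 0, 0]
  have h1 := h ![0, 1, 0]
  have h2 := h ![0, 0, 1]
  have h3 := h ![1, 1, 0]
  have h4 := h ![1, 0, 1]
  simp [mdot, lcross] at h0 h1 h2 h3 h4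
  apply hv
  have key : v 0 = 0 ∧ v 1 = 0 ∧ v 2 = 0 := by
    grind
  ext i
  fin_cases i <;> simp [key]

lemma commute_lcrossMatrix {g : Matrix (Fin 3) (Fin 3) ℝ} (hg : isLorentz g) (hdet : g.det = 1)
    {v : V3} (hv : g.mulVec v = v) : Commute g (lcrossMatrix v) := by
  refine Matrix.mulVec_injective (funext fun x => ?_)
  rw [← Matrix.mulVec_mulVec, ← Matrix.mulVec_mulVec, lcrossMatrix_mulVec, lcrossMatrix_mulVec,
    ← lcross_mulVec hg hdet, hv]

/-- The stabilizer of a nonzero vector in `SO(2,1)` is commutative. -/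
lemma commute_of_common_fixed {A B : Matrix (Fin 3) (Fin 3) ℝ} (hA : isLorentz A)
    (hAdet : A.det = 1) (hB : isLorentz B) (hBdet : B.det = 1) {v : V3} (hv : v ≠ 0)
    (hAv : A.mulVec v = v) (hBv : B.mulVec v = v) : Commute A B := by
  obtain ⟨y, hy⟩ := exists_cyclic_lcross hv
  set N := lcrossMatrix v with hN
  have hAN : Commute A N := commute_lcrossMatrix hA hAdet hAv
  have hBN : Commute B N := commute_lcrossMatrix hB hBdet hBv
  simp only [← lcrossMatrix_mulVec v, ← hN] at hy
  set d := mdot y (lcross (N.mulVec y) (N.mulVec (N.mulVec y))) with hd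
  obtain ⟨a, b, c, habc⟩ : ∃ a b c : ℝ,
      d • A.mulVec y = a • y + b • N.mulVec y + c • N.mulVec (N.mulVec y) :=
    ⟨_, _, _, mdot_lcross_smul _ _ _ _⟩
  set P : Matrix (Fin 3) (Fin 3) ℝ := a • 1 + b • N + c • (N * N) with hP
  have hPcomm : ∀ {C : Matrix (Fin 3) (Fin 3) ℝ}, Commute C N → Commute C P := fun hC =>
    (((Commute.one_right _).smul_right a).add_right (hC.smul_right b)).add_right
      ((hC.mul_right hC).smul_right c)
  set D := d • A - P with hD
  have hDN : Commute D N := (hAN.smul_left d).sub_left (hPcomm (Commute.refl N)).symm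
  have hDy : D.mulVec y = 0 := by
    simp [hD, hP, Matrix.sub_mulVec, Matrix.add_mulVec, Matrix.smul_mulVec, habc]
  have hDN' : ∀ x, D.mulVec x = 0 → D.mulVec (N.mulVec x) = 0 := fun x hx => by
    rw [Matrix.mulVec_mulVec, hDN.eq, ← Matrix.mulVec_mulVec, hx, Matrix.mulVec_zero]
  have hD0 : D = 0 := by
    refine Matrix.mulVec_injective (funext fun x => ?_)
    have hx := congrArg D.mulVec (mdot_lcross_smul y (N.mulVec y) (N.mulVec (N.mulVec y)) x)
    simp only [Matrix.mulVec_add, Matrix.mulVec_smul, hDy, hDN' _ hDy, hDN' _ (hDN' _ hDy),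
      ← hd, smul_zero, add_zero] at hx
    rw [(smul_eq_zero.mp hx).resolve_left hy, Matrix.zero_mulVec]
  have hAP : A = d⁻¹ • P := by
    rw [← sub_eq_zero.mp hD0, smul_smul, inv_mul_cancel₀ hy, one_smul]
  rw [hAP]
  exact ((hPcomm hBN).symm).smul_left _

section Cocycle

variable {ρ : FreeGroup (Fin 2) →* GL (Fin 3) ℝ}

/-- A representation of the free group of rank two whose generators have commuting images has
solvable image. -/
lemma isSolvable_range_of_commute (h : Commute (ρ (FreeGroup.of 0)) (ρ (FreeGroup.of 1))) :
    Group.IsSolvable ρ.range := by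
  have hgen : ∀ i j : Fin 2, Commute (ρ (FreeGroup.of i)) (ρ (FreeGroup.of j)) := by
    intro i j
    fin_cases i <;> fin_cases j
    exacts [Commute.refl _, h, h.symm, Commute.refl _]
  have hone : ∀ (i : Fin 2) (b : FreeGroup (Fin 2)), Commute (ρ (FreeGroup.of i)) (ρ b) := by
    intro i b
    induction b using FreeGroup.induction_on with
    | C1 => simp
    | of j => exact hgen i j
    | inv_of j hj => rw [map_inv]; exact (hgen i j).inv_right
    | mul x y hx hy => rw [map_mul]; exact hx.mul_right hy
  have hall : ∀ a b : FreeGroup (Fin 2), Commute (ρ a) (ρ b) := by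
    intro a b
    induction a using FreeGroup.induction_on with
    | C1 => simp
    | of j => exact hone j b
    | inv_of j hj => rw [map_inv]; exact (hone j b).inv_left
    | mul x y hx hy => rw [map_mul]; exact hx.mul_left hy
  refine Group.isSolvable_of_comm ?_
  rintro ⟨_, a, rfl⟩ ⟨_, b, rfl⟩
  exact Subtype.ext (hall a b)

/-- `u` is a cocycle for the action of the free group on `ℝ³` through `ρ`. -/
def IsLinearCocycle (ρ : FreeGroup (Fin 2) →* GL (Fin 3) ℝ) (u : FreeGroup (Fin 2) → V3) : Prop :=
  ∀ a b, u (a * b) = u a + (ρ a).val.mulVec (u b)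

lemma mulVec_inv_mulVec (a : FreeGroup (Fin 2)) (x : V3) :
    (ρ a⁻¹).val.mulVec ((ρ a).val.mulVec x) = x := by
  rw [Matrix.mulVec_mulVec, ← Units.val_mul, ← map_mul]
  simp

lemma mulVec_mulVec_inv (a : FreeGroup (Fin 2)) (x : V3) :
    (ρ a).val.mulVec ((ρ a⁻¹).val.mulVec x) = x := by
  rw [Matrix.mulVec_mulVec, ← Units.val_mul, ← map_mul]
  simp

namespace IsLinearCocycle

variable {u : FreeGroup (Fin 2) → V3}

lemma map_one (hu : IsLinearCocycle ρ u) : u 1 = 0 := by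
  simpa using hu 1 1

lemma map_inv (hu : IsLinearCocycle ρ u) (a : FreeGroup (Fin 2)) :
    u a⁻¹ = -(ρ a⁻¹).val.mulVec (u a) := by
  have h := hu a⁻¹ a
  rw [inv_mul_cancel, hu.map_one] at h
  exact eq_neg_of_add_eq_zero_left h.symm

lemma ext_generators {u' : FreeGroup (Fin 2) → V3} (hu : IsLinearCocycle ρ u)
    (hu' : IsLinearCocycle ρ u') (h0 : u (FreeGroup.of 0) = u' (FreeGroup.of 0))
    (h1 : u (FreeGroup.of 1) = u' (FreeGroup.of 1)) (a : FreeGroup (Fin 2)) : u a = u' a := by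
  induction a using FreeGroup.induction_on with
  | C1 => rw [hu.map_one, hu'.map_one]
  | of j => fin_cases j <;> assumption
  | inv_of j hj => rw [hu.map_inv, hu'.map_inv, hj]
  | mul x y hx hy => rw [hu, hu', hx, hy]

lemma coboundary (w : V3) : IsLinearCocycle ρ fun a => (ρ a).val.mulVec w - w := by
  intro a b
  simp [Matrix.mulVec_sub, Matrix.mulVec_mulVec]

/-- The pairing of a cocycle at `(a * b)⁻¹` with a fixed vector, in terms of its values at `a`
and `b`. -/
lemma mdot_inv_mul (hu : IsLinearCocycle ρ u) (hρ : ∀ a, isLorentz (ρ a).val)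
    {a b : FreeGroup (Fin 2)} {v : V3} (hv : (ρ (a * b)⁻¹).val.mulVec v = v) :
    mdot (u (a * b)⁻¹) v = -mdot (u a) v - mdot (u b) ((ρ a⁻¹).val.mulVec v) := by
  have h1 : mdot (u (a * b)⁻¹) v = -mdot (u (a * b)) v := by
    rw [← hρ (a * b)⁻¹ (u (a * b)) v, hv, hu.map_inv]
    simp [mdot]
    ring
  rw [h1, ← hρ a (u b), mulVec_mulVec_inv, hu]
  simp [mdot]
  ring

end IsLinearCocycle

/-- Cocycles on a free group take arbitrary values on the generators. -/
lemma exists_isLinearCocycle (ρ : FreeGroup (Fin 2) →* GL (Fin 3) ℝ) (p q : V3) :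
    ∃ u, IsLinearCocycle ρ u ∧ u (FreeGroup.of 0) = p ∧ u (FreeGroup.of 1) = q := by
  let gen (i : Fin 2) : Equiv.Perm V3 :=
    { toFun := fun x => (ρ (FreeGroup.of i)).val.mulVec x + ![p, q] i
      invFun := fun x => (ρ (FreeGroup.of i)⁻¹).val.mulVec (x - ![p, q] i)
      left_inv := fun x => by
        beta_reduce
        rw [add_sub_cancel_right, mulVec_inv_mulVec]
      right_inv := fun x => by
        beta_reduce
        rw [mulVec_mulVec_inv, sub_add_cancel] }
  let F : FreeGroup (Fin 2) →* Equiv.Perm V3 := FreeGroup.lift gen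
  have hgen (i : Fin 2) (x : V3) :
      F (FreeGroup.of i) x = (ρ (FreeGroup.of i)).val.mulVec x + ![p, q] i := by
    simp only [F, FreeGroup.lift_apply_of]
    rfl
  have hF (a : FreeGroup (Fin 2)) (x : V3) : F a x = (ρ a).val.mulVec x + F a 0 := by
    induction a using FreeGroup.induction_on generalizing x with
    | C1 => simp
    | of j => simp only [hgen, Matrix.mulVec_zero, zero_add]
    | inv_of j hj =>
      rw [map_inv, Equiv.Perm.inv_eq_iff_eq, hj, Matrix.mulVec_add, mulVec_mulVec_inv, add_assoc,
        ← hj, Equiv.Perm.inv_def, Equiv.apply_symm_apply, add_zero]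
    | mul a b ha hb =>
      rw [map_mul, map_mul, Equiv.Perm.mul_apply, Equiv.Perm.mul_apply, hb, ha, ha (F b 0),
        Units.val_mul, ← Matrix.mulVec_mulVec, Matrix.mulVec_add, add_assoc]
  refine ⟨fun a => F a 0, fun a b => ?_, ?_, ?_⟩
  · simp only [map_mul, Equiv.Perm.mul_apply]
    rw [hF, add_comm]
  · simp [hgen]
  · simp [hgen]

end Cocycle

/-- Pairing with a fixed vector, as a linear form. -/
def mdotLinear (v : V3) : V3 →ₗ[ℝ] ℝ where
  toFun x := mdot x v
  map_add' x y := by simp [mdot]; ring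
  map_smul' r x := by simp [mdot]; ring

/-- The three coordinates of a cocycle with values `p`, `q` on the generators, where `v₃'` is the
translate of `v₃` under the inverse of the first generator. -/
def cocycleCoordinates (v1 v2 v3 v3' : V3) : V3 × V3 →ₗ[ℝ] ℝ × ℝ × ℝ :=
  (mdotLinear v1 ∘ₗ LinearMap.fst ℝ V3 V3).prod
    ((mdotLinear v2 ∘ₗ LinearMap.snd ℝ V3 V3).prod
      (-(mdotLinear v3 ∘ₗ LinearMap.fst ℝ V3 V3) - mdotLinear v3' ∘ₗ LinearMap.snd ℝ V3 V3))

lemma cocycleCoordinates_apply (v1 v2 v3 v3' p q : V3) :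
    cocycleCoordinates v1 v2 v3 v3' (p, q) =
      (mdot p v1, mdot q v2, -mdot p v3 - mdot q v3') := rfl

lemma cocycleCoordinates_surjective {v1 v2 v3 v3' : V3} (h1 : v1 ≠ 0) (h2 : v2 ≠ 0)
    (h : ∀ s t : ℝ, ¬ (v3 = s • v1 ∧ v3' = t • v2)) :
    Function.Surjective (cocycleCoordinates v1 v2 v3 v3') := by
  rw [← LinearMap.range_eq_top]
  by_contra hne
  obtain ⟨f, hf, hle⟩ := Submodule.exists_le_ker_of_lt_top _ (lt_top_iff_ne_top.mpr hne)
  set a := f (1, 0, 0) with ha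
  set b := f (0, 1, 0) with hb
  set c := f (0, 0, 1) with hc
  have hfxyz (x y z : ℝ) : f (x, y, z) = x * a + y * b + z * c := by
    have : ((x, y, z) : ℝ × ℝ × ℝ) = x • (1, 0, 0) + y • (0, 1, 0) + z • (0, 0, 1) := by simp
    rw [this, map_add, map_add, map_smul, map_smul, map_smul]
    simp [ha, hb, hc]
  have hrel (p q : V3) :
      mdot p v1 * a + mdot q v2 * b + (-mdot p v3 - mdot q v3') * c = 0 := by
    rw [← hfxyz, ← cocycleCoordinates_apply]
    exact hle ⟨(p, q), rfl⟩
  have e1 : a • v1 = c • v3 := eq_of_forall_mdot_eq fun p => by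
    have := hrel p 0
    simp [mdot] at this ⊢
    linarith
  have e2 : b • v2 = c • v3' := eq_of_forall_mdot_eq fun q => by
    have := hrel 0 q
    simp [mdot] at this ⊢
    linarith
  by_cases hc0 : c = 0
  · rw [hc0, zero_smul] at e1 e2
    have ha0 := (smul_eq_zero.mp e1).resolve_right h1
    have hb0 := (smul_eq_zero.mp e2).resolve_right h2
    refine hf (LinearMap.ext fun ⟨x, y, z⟩ => ?_)
    simp [hfxyz, ha0, hb0, hc0]
  · refine h (c⁻¹ * a) (c⁻¹ * b) ⟨?_, ?_⟩
    · rw [mul_smul, e1, inv_smul_smul₀ hc0]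
    · rw [mul_smul, e2, inv_smul_smul₀ hc0]

lemma mdot_mulVec_sub_of_fixed {g : Matrix (Fin 3) (Fin 3) ℝ} (hg : isLorentz g) {v : V3}
    (hv : g.mulVec v = v) (w : V3) : mdot (g.mulVec w - w) v = 0 := by
  have h := hg w v
  rw [hv] at h
  simp [mdot] at h ⊢
  linarith

/-- For a representation `ρ` of the rank-two free group
`π = ⟨A₁, A₂⟩` into `SO(2,1)⁰` with nonsolvable image, `ρ(Aᵢ)` hyperbolic or
parabolic for `i = 1,2,3` (where `A₃ = (A₁A₂)⁻¹`), and positive fixed vectors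
`vᵢ` of `ρ(Aᵢ)`, the map `[u] ↦ (u(A₁)·v₁, u(A₂)·v₂, u(A₃)·v₃)` is a
well-defined linear isomorphism `H¹(π,ℝ³) → ℝ³`: every triple is achieved by a
cocycle, and a cocycle maps to `0` if and only if it is a coboundary. -/
theorem margulis_coordinates_iso
    (ρ : FreeGroup (Fin 2) →* GL (Fin 3) ℝ)
    (hSO : ∀ a : FreeGroup (Fin 2), inSO21p ((ρ a : GL (Fin 3) ℝ) : Matrix (Fin 3) (Fin 3) ℝ))
    (hns : ¬ IsSolvable ρ.range)
    (v1 v2 v3 : V3)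
    (ht1 : isHyperbolic ((ρ (FreeGroup.of 0) : GL (Fin 3) ℝ) : Matrix (Fin 3) (Fin 3) ℝ) ∨
           isParabolic ((ρ (FreeGroup.of 0) : GL (Fin 3) ℝ) : Matrix (Fin 3) (Fin 3) ℝ))
    (ht2 : isHyperbolic ((ρ (FreeGroup.of 1) : GL (Fin 3) ℝ) : Matrix (Fin 3) (Fin 3) ℝ) ∨
           isParabolic ((ρ (FreeGroup.of 1) : GL (Fin 3) ℝ) : Matrix (Fin 3) (Fin 3) ℝ))
    (ht3 : isHyperbolic ((ρ ((FreeGroup.of 0 * FreeGroup.of 1)⁻¹) : GL (Fin 3) ℝ) : Matrix (Fin 3) (Fin 3) ℝ) ∨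
           isParabolic ((ρ ((FreeGroup.of 0 * FreeGroup.of 1)⁻¹) : GL (Fin 3) ℝ) : Matrix (Fin 3) (Fin 3) ℝ))
    (hv1 : positiveFixed ((ρ (FreeGroup.of 0) : GL (Fin 3) ℝ) : Matrix (Fin 3) (Fin 3) ℝ) v1)
    (hv2 : positiveFixed ((ρ (FreeGroup.of 1) : GL (Fin 3) ℝ) : Matrix (Fin 3) (Fin 3) ℝ) v2)
    (hv3 : positiveFixed ((ρ ((FreeGroup.of 0 * FreeGroup.of 1)⁻¹) : GL (Fin 3) ℝ) : Matrix (Fin 3) (Fin 3) ℝ) v3) :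
    (∀ m1 m2 m3 : ℝ, ∃ u : FreeGroup (Fin 2) → V3,
      (∀ a b : FreeGroup (Fin 2),
        u (a * b) = u a + ((ρ a : GL (Fin 3) ℝ) : Matrix (Fin 3) (Fin 3) ℝ).mulVec (u b)) ∧
      mdot (u (FreeGroup.of 0)) v1 = m1 ∧
      mdot (u (FreeGroup.of 1)) v2 = m2 ∧
      mdot (u ((FreeGroup.of 0 * FreeGroup.of 1)⁻¹)) v3 = m3) ∧
    (∀ u : FreeGroup (Fin 2) → V3,
      (∀ a b : FreeGroup (Fin 2),
        u (a * b) = u a + ((ρ a : GL (Fin 3) ℝ) : Matrix (Fin 3) (Fin 3) ℝ).mulVec (u b)) →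
      ((mdot (u (FreeGroup.of 0)) v1 = 0 ∧
        mdot (u (FreeGroup.of 1)) v2 = 0 ∧
        mdot (u ((FreeGroup.of 0 * FreeGroup.of 1)⁻¹)) v3 = 0) ↔
       ∃ w : V3, ∀ a : FreeGroup (Fin 2),
         u a = ((ρ a : GL (Fin 3) ℝ) : Matrix (Fin 3) (Fin 3) ℝ).mulVec w - w)) := by
  have hL (a) : isLorentz (ρ a).val := (hSO a).1
  have hfix : ∀ v : V3, (ρ (FreeGroup.of 0)).val.mulVec v = v →
      (ρ (FreeGroup.of 1)).val.mulVec v = v → v = 0 := by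
    intro v hA hB
    by_contra hv
    exact hns <| isSolvable_range_of_commute <| Units.ext <|
      (commute_of_common_fixed (hL _) (hSO _).2.1 (hL _) (hSO _).2.1 hv hA hB).eq
  obtain ⟨hv1, hf1, -⟩ := hv1
  obtain ⟨hv2, hf2, -⟩ := hv2
  obtain ⟨hv3, hf3, -⟩ := hv3
  set A := ρ (FreeGroup.of 0) with hA
  set B := ρ (FreeGroup.of 1) with hB
  set v3' : V3 := (ρ (FreeGroup.of 0)⁻¹).val.mulVec v3 with hv3'
  have hcoord : ∀ u, IsLinearCocycle ρ u →
      cocycleCoordinates v1 v2 v3 v3' (u (FreeGroup.of 0), u (FreeGroup.of 1)) =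
        (mdot (u (FreeGroup.of 0)) v1, mdot (u (FreeGroup.of 1)) v2,
          mdot (u (FreeGroup.of 0 * FreeGroup.of 1)⁻¹) v3) := fun u hu => by
    rw [cocycleCoordinates_apply, hu.mdot_inv_mul hL hf3]
  have hsurj : Function.Surjective (cocycleCoordinates v1 v2 v3 v3') := by
    refine cocycleCoordinates_surjective hv1 hv2 fun s t ⟨hs, ht⟩ => hv3 ?_
    have hAv : A.val.mulVec v3 = v3 := by rw [hs, Matrix.mulVec_smul, hf1]
    have hv33 : v3' = v3 := by
      rw [hv3']
      nth_rewrite 1 [← hAv]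
      rw [hA, mulVec_inv_mulVec]
    refine hfix v3 hAv ?_
    rw [← hv33, ht, Matrix.mulVec_smul, hf2]
  let ψ : V3 →ₗ[ℝ] V3 × V3 :=
    (Matrix.mulVecLin A.val - LinearMap.id).prod (Matrix.mulVecLin B.val - LinearMap.id)
  have hψ (w : V3) : ψ w = (A.val.mulVec w - w, B.val.mulVec w - w) := rfl
  have hψinj : Function.Injective ψ := by
    rw [← LinearMap.ker_eq_bot, LinearMap.ker_eq_bot']
    intro w hw
    rw [hψ, Prod.mk_eq_zero, sub_eq_zero, sub_eq_zero] at hw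
    exact hfix w hw.1 hw.2
  have hcob (w : V3) : mdot (A.val.mulVec w - w) v1 = 0 ∧ mdot (B.val.mulVec w - w) v2 = 0 ∧
      mdot ((ρ (FreeGroup.of 0 * FreeGroup.of 1)⁻¹).val.mulVec w - w) v3 = 0 :=
    ⟨mdot_mulVec_sub_of_fixed (hL _) hf1 w, mdot_mulVec_sub_of_fixed (hL _) hf2 w,
      mdot_mulVec_sub_of_fixed (hL _) hf3 w⟩
  have hexact : LinearMap.range ψ = LinearMap.ker (cocycleCoordinates v1 v2 v3 v3') := by
    refine Submodule.eq_of_le_of_finrank_eq ?_ ?_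
    · rintro _ ⟨w, rfl⟩
      obtain ⟨c1, c2, c3⟩ := hcob w
      rw [LinearMap.mem_ker, hψ]
      refine (hcoord _ (IsLinearCocycle.coboundary w)).trans ?_
      simp only [← hA, ← hB, c1, c2, c3]
      rfl
    · have hker := LinearMap.finrank_range_add_finrank_ker (cocycleCoordinates v1 v2 v3 v3')
      rw [LinearMap.range_eq_top.mpr hsurj, finrank_top] at hker
      rw [LinearMap.finrank_range_of_inj hψinj]
      simp at hker ⊢
      omega
  refine ⟨fun m1 m2 m3 => ?_, fun u hu => ⟨fun ⟨h1, h2, h3⟩ => ?_, ?_⟩⟩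
  · obtain ⟨⟨p, q⟩, hpq⟩ := hsurj (m1, m2, m3)
    obtain ⟨u, hu, rfl, rfl⟩ := exists_isLinearCocycle ρ p q
    rw [hcoord u hu, Prod.mk.injEq, Prod.mk.injEq] at hpq
    exact ⟨u, hu, hpq⟩
  · have hmem : (u (FreeGroup.of 0), u (FreeGroup.of 1)) ∈ LinearMap.range ψ := by
      rw [hexact, LinearMap.mem_ker, hcoord u hu, h1, h2, h3]
      rfl
    obtain ⟨w, hw⟩ := hmem
    rw [hψ, Prod.mk.injEq] at hw
    exact ⟨w, IsLinearCocycle.ext_generators hu (IsLinearCocycle.coboundary w)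
      hw.1.symm hw.2.symm⟩
  · rintro ⟨w, hw⟩
    simp only [hw]
    exact hcob w
end
end
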